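/- Let μ₀ ∈ ℝ, σ₀ > 0 and τ_l < τ_u, let X be a random variable with the truncated normal distribution TN(μ₀,σ₀,τ_l,τ_u) and let F be its cumulative distribution function. Then ∫_{τ_l}^{τ_u} ∫_{τ_l}^{τ_u} ((y−μ₀)/σ₀) · (F(min(x,y)) − F(x)F(y)) dy dx = (σ₀/2)·( E[ X·((X−μ₀)/σ₀)² ] − E[ ((X−μ₀)/σ₀)² ]·E[X] ). That is, the double integral equals the covariance of X and (σ₀/2)((X−μ₀)/σ₀)². -/

import Mathlib

open Real

/-- The standard normal density `φ(x) = (1/√(2π)) e^{-x²/2}`. -/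
noncomputable def stdPhi (x : ℝ) : ℝ := (Real.sqrt (2 * Real.pi))⁻¹ * Real.exp (-(x ^ 2) / 2)

/-- The standard normal cumulative distribution function `Φ`. -/
noncomputable def stdPhiCDF (x : ℝ) : ℝ := ∫ t in Set.Iic x, stdPhi t

/-- The density of the truncated normal distribution `TN(μ,σ,τ_l,τ_u)` on `[τ_l, τ_u]`. -/
noncomputable def truncNormalPDF (μ σ τl τu : ℝ) (t : ℝ) : ℝ :=
  (1 / σ) * stdPhi ((t - μ) / σ) /
    (stdPhiCDF ((τu - μ) / σ) - stdPhiCDF ((τl - μ) / σ))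

/-- **Hoeffding's covariance identity** on an interval `[a, b]`, for a continuous density `f` of
total mass one, applied to the identity and a `C¹` function `g`. -/
theorem integral_integral_deriv_mul_cdf_min_sub {a b : ℝ} (hab : a ≤ b) {f g g' : ℝ → ℝ}
    (hf : Continuous f) (hg : ∀ x, HasDerivAt g (g' x) x) (hg' : Continuous g')
    {F : ℝ → ℝ} (hF : ∀ t, F t = ∫ s in a..t, f s) (hFb : F b = 1) :
    (∫ x in a..b, ∫ y in a..b, g' y * (F (min x y) - F x * F y)) =
      (∫ x in a..b, x * g x * f x) - (∫ x in a..b, g x * f x) * ∫ x in a..b, x * f x := by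
  have hFa : F a = 0 := by simp [hF]
  have hFd (x : ℝ) : HasDerivAt F (f x) x := by
    rw [funext hF]
    exact hf.integral_hasStrictDerivAt a x |>.hasDerivAt
  have hFc : Continuous F := continuous_iff_continuousAt.2 fun x => (hFd x).continuousAt
  have hgc : Continuous g := continuous_iff_continuousAt.2 fun x => (hg x).continuousAt
  have hgf : Continuous fun x => g x * f x := hgc.mul hf
  obtain ⟨G, hG⟩ : ∃ G : ℝ → ℝ, ∀ t, G t = ∫ s in a..t, g s * f s := ⟨_, fun _ => rfl⟩
  have hGa : G a = 0 := by simp [hG]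
  have hGd (x : ℝ) : HasDerivAt G (g x * f x) x := by
    rw [funext hG]
    exact hgf.integral_hasStrictDerivAt a x |>.hasDerivAt
  have integral_mul_cdf (x : ℝ) : ∫ y in a..x, g' y * F y = g x * F x - G x := by
    have := intervalIntegral.integral_eq_sub_of_hasDerivAt
      (fun y _ => ((hg y).mul (hFd y)).sub (hGd y)) (a := a) (b := x)
      (Continuous.intervalIntegrable (by fun_prop) _ _)
    simpa [hFa, hGa] using this
  have inner (x : ℝ) (hx : x ∈ Set.uIcc a b) :
      ∫ y in a..b, g' y * (F (min x y) - F x * F y) = G b * F x - G x := by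
    rw [Set.uIcc_of_le hab] at hx
    have left : ∫ y in a..x, g' y * F (min x y) = ∫ y in a..x, g' y * F y := by
      refine intervalIntegral.integral_congr fun y hy => ?_
      rw [Set.uIcc_of_le hx.1] at hy
      simp only [min_eq_right hy.2]
    have right : ∫ y in x..b, g' y * F (min x y) = (g b - g x) * F x := by
      rw [← intervalIntegral.integral_eq_sub_of_hasDerivAt (fun y _ => hg y)
        (hg'.intervalIntegrable _ _), ← intervalIntegral.integral_mul_const]
      refine intervalIntegral.integral_congr fun y hy => ?_
      rw [Set.uIcc_of_le hx.2] at hy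
      simp only [min_eq_left hy.1]
    have hmin : Continuous fun y => g' y * F (min x y) := by fun_prop
    have split : ∫ y in a..b, g' y * (F (min x y) - F x * F y) =
        (∫ y in a..b, g' y * F (min x y)) - F x * ∫ y in a..b, g' y * F y := by
      rw [← intervalIntegral.integral_const_mul, ← intervalIntegral.integral_sub
        (hmin.intervalIntegrable _ _) (Continuous.intervalIntegrable (by fun_prop) _ _)]
      exact intervalIntegral.integral_congr fun y _ => by ring
    rw [split, ← intervalIntegral.integral_add_adjacent_intervals
      (hmin.intervalIntegrable a x) (hmin.intervalIntegrable x b), left, right,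
      integral_mul_cdf, integral_mul_cdf, hFb]
    ring
  have parts := intervalIntegral.integral_deriv_mul_eq_sub (a := a) (b := b)
    (fun x _ => hasDerivAt_id x) (fun x _ => ((hFd x).const_mul (G b)).sub (hGd x))
    (Continuous.intervalIntegrable (by fun_prop) _ _)
    (Continuous.intervalIntegrable (by fun_prop) _ _)
  have hGc : Continuous G := continuous_iff_continuousAt.2 fun x => (hGd x).continuousAt
  have hi₁ : Continuous fun x => G b * F x - G x := by fun_prop
  have hi₂ : Continuous fun x => G b * (x * f x) - x * g x * f x := by fun_prop
  have expand : (∫ x in a..b, (G b * F x - G x)) +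
      ∫ x in a..b, (G b * (x * f x) - x * g x * f x) = 0 := by
    rw [← intervalIntegral.integral_add (hi₁.intervalIntegrable _ _)
      (hi₂.intervalIntegrable _ _)]
    refine Eq.trans (intervalIntegral.integral_congr fun x _ => ?_) (parts.trans ?_)
    · simp only [id, Pi.sub_apply]
      ring
    · simp [hFa, hGa, hFb]
  have sub : ∫ x in a..b, (G b * (x * f x) - x * g x * f x) =
      G b * (∫ x in a..b, x * f x) - ∫ x in a..b, x * g x * f x := by
    rw [intervalIntegral.integral_sub (Continuous.intervalIntegrable (by fun_prop) _ _)
      (Continuous.intervalIntegrable (by fun_prop) _ _), intervalIntegral.integral_const_mul]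
  rw [intervalIntegral.integral_congr inner, ← hG]
  linarith

theorem continuous_stdPhi : Continuous stdPhi := by
  unfold stdPhi
  fun_prop

theorem stdPhi_pos (x : ℝ) : 0 < stdPhi x := by
  unfold stdPhi
  positivity

theorem integrable_stdPhi : MeasureTheory.Integrable stdPhi := by
  have := (integrable_exp_neg_mul_sq (b := 1 / 2) (by norm_num)).const_mul (√(2 * π))⁻¹
  refine this.congr (.of_forall fun x => ?_)
  simp only [stdPhi]
  ring_nf

theorem stdPhiCDF_sub (a b : ℝ) : stdPhiCDF b - stdPhiCDF a = ∫ t in a..b, stdPhi t :=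
  intervalIntegral.integral_Iic_sub_Iic integrable_stdPhi.integrableOn
    integrable_stdPhi.integrableOn

theorem continuous_truncNormalPDF (μ σ τl τu : ℝ) : Continuous (truncNormalPDF μ σ τl τu) := by
  have := continuous_stdPhi
  unfold truncNormalPDF
  fun_prop

theorem integral_truncNormalPDF {μ σ τl τu : ℝ} (hσ : 0 < σ) (h : τl < τu) :
    ∫ t in τl..τu, truncNormalPDF μ σ τl τu t = 1 := by
  have hlt : (τl - μ) / σ < (τu - μ) / σ := by gcongr
  have hpos : 0 < ∫ t in (τl - μ) / σ..(τu - μ) / σ, stdPhi t :=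
    intervalIntegral.intervalIntegral_pos_of_pos (continuous_stdPhi.intervalIntegrable _ _)
      stdPhi_pos hlt
  have hsubst : ∫ t in τl..τu, stdPhi ((t - μ) / σ) =
      σ * ∫ t in (τl - μ) / σ..(τu - μ) / σ, stdPhi t := by
    simp only [sub_div]
    simp [intervalIntegral.integral_comp_div_sub _ hσ.ne']
  unfold truncNormalPDF
  rw [stdPhiCDF_sub, intervalIntegral.integral_div, intervalIntegral.integral_const_mul, hsubst]
  field_simp

/-- For `X ∼ TN(μ₀,σ₀,τ_l,τ_u)` with density `f` and CDF `F(t) = ∫_{τ_l}^t f`,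
`∫_{τ_l}^{τ_u} ∫_{τ_l}^{τ_u} ((y−μ₀)/σ₀)(F(min(x,y)) − F(x)F(y)) dy dx
  = (σ₀/2)(E[X((X−μ₀)/σ₀)²] − E[((X−μ₀)/σ₀)²] E[X])`,
the covariance of `X` and `(σ₀/2)((X−μ₀)/σ₀)²`. -/
theorem stmt15 (μ₀ σ₀ τl τu : ℝ) (hσ : 0 < σ₀) (h : τl < τu)
    (f : ℝ → ℝ) (hf : ∀ t : ℝ, f t = truncNormalPDF μ₀ σ₀ τl τu t)
    (F : ℝ → ℝ) (hF : ∀ t : ℝ, F t = ∫ s in τl..t, f s) :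
    (∫ x in τl..τu, ∫ y in τl..τu, ((y - μ₀) / σ₀) * (F (min x y) - F x * F y)) =
      (σ₀ / 2) * ((∫ x in τl..τu, x * ((x - μ₀) / σ₀) ^ 2 * f x) -
        (∫ x in τl..τu, ((x - μ₀) / σ₀) ^ 2 * f x) * (∫ x in τl..τu, x * f x)) := by
  have hfe : f = truncNormalPDF μ₀ σ₀ τl τu := funext hf
  have hfc : Continuous f := hfe ▸ continuous_truncNormalPDF μ₀ σ₀ τl τu
  have hFu : F τu = 1 := by rw [hF, hfe, integral_truncNormalPDF hσ h]
  have hg (x : ℝ) : HasDerivAt (fun y => σ₀ / 2 * ((y - μ₀) / σ₀) ^ 2) ((x - μ₀) / σ₀) x := by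
    refine (((((hasDerivAt_id' x).sub_const μ₀).div_const σ₀).pow 2).const_mul
      (σ₀ / 2)).congr_deriv ?_
    push_cast
    field_simp
  have pull (u v : ℝ → ℝ) : ∫ x in τl..τu, u x * (σ₀ / 2 * v x) * f x =
      σ₀ / 2 * ∫ x in τl..τu, u x * v x * f x := by
    rw [← intervalIntegral.integral_const_mul]
    exact intervalIntegral.integral_congr fun x _ => by ring
  have pull_one := pull 1 fun x => ((x - μ₀) / σ₀) ^ 2
  simp only [Pi.one_apply, one_mul] at pull_one
  rw [integral_integral_deriv_mul_cdf_min_sub h.le hfc hg (by fun_prop) hF hFu,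
    pull (fun x => x), pull_one]
  ring
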